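/- Let β ∈ 𝔽_{q^m} with β ≠ 0 and λ ∈ 𝔽_q with λ ≠ 0, and set N₁ = Σ_{a ∈ 𝔽_{q^m}} Σ_{x ∈ 𝔽_q\{0}} Σ_{z ∈ 𝔽_q\{0}} ζ_q^{x·Tr(a²)} · ζ_q^{z·Tr(βa) − zλ} ∈ ℂ. Then: N₁ = −(q−1)·G if m is even and Tr(β²) = 0; N₁ = G if m is even and Tr(β²) ≠ 0; N₁ = 0 if m is odd and Tr(β²) = 0; and N₁ = −η̄(−Tr(β²))·G·Ḡ if m is odd and Tr(β²) ≠ 0. -/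

import Mathlib

open Finset

/-- The additive character `s ↦ exp(2πi·s̃/q)` of `ZMod q`. -/
noncomputable def zetaQ (q : ℕ) (s : ZMod q) : ℂ :=
  Complex.exp (2 * Real.pi * Complex.I * (s.val : ℂ) / (q : ℂ))

/-- The quadratic Gauss sum `G` over the big field `F`. -/
noncomputable def gaussBig (q : ℕ) [Fact q.Prime] (F : Type*) [Field F] [Fintype F]
    [DecidableEq F] [Algebra (ZMod q) F] : ℂ :=
  ∑ x ∈ Finset.univ.filter (fun x : F => x ≠ 0),
    (quadraticChar F x : ℂ) * zetaQ q (Algebra.trace (ZMod q) F x)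

/-- The quadratic Gauss sum `Ḡ` over the prime field `ZMod q`. -/
noncomputable def gaussSmall (q : ℕ) [Fact q.Prime] : ℂ :=
  ∑ y ∈ Finset.univ.filter (fun y : ZMod q => y ≠ 0),
    (quadraticChar (ZMod q) y : ℂ) * zetaQ q y

/-- The character sum `N₁` of Lemma 3.2. -/
noncomputable def None (q : ℕ) [Fact q.Prime] (F : Type*) [Field F] [Fintype F]
    [DecidableEq F] [Algebra (ZMod q) F] (β : F) (lam : ZMod q) : ℂ :=
  ∑ a : F, ∑ x ∈ Finset.univ.filter (fun x : ZMod q => x ≠ 0),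
    ∑ z ∈ Finset.univ.filter (fun z : ZMod q => z ≠ 0),
      zetaQ q (x * Algebra.trace (ZMod q) F (a ^ 2)) *
        zetaQ q (z * Algebra.trace (ZMod q) F (β * a) - z * lam)

/-- `zetaQ` is the standard additive character of `ZMod q`. -/
lemma zetaQ_eq_stdAddChar (q : ℕ) [NeZero q] (s : ZMod q) : zetaQ q s = ZMod.stdAddChar s := by
  have h := ZMod.stdAddChar_coe (N := q) (s.val : ℤ)
  have hs : (((s.val : ℕ) : ℤ) : ZMod q) = s := by simp
  rw [hs] at h
  rw [h, zetaQ]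
  push_cast
  rfl

section FiniteField

variable {K : Type*} [Field K] [Fintype K] [DecidableEq K]

/-- The quadratic Gauss sum as a sum over squares. -/
lemma sum_addChar_sq (hK : ringChar K ≠ 2) {ψ : AddChar K ℂ} (hψ : ψ ≠ 1) :
    ∑ a : K, ψ (a ^ 2) = ∑ y : K, (quadraticChar K y : ℂ) * ψ y := by
  have hcard (y : K) : ((univ.filter fun a : K => a ^ 2 = y).card : ℂ)
      = (quadraticChar K y : ℂ) + 1 := by
    have h := quadraticChar_card_sqrts hK y
    have h' : {x : K | x ^ 2 = y}.toFinset = univ.filter fun a : K => a ^ 2 = y := by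
      ext; simp
    rw [h'] at h
    exact_mod_cast h
  have hfib : ∑ a : K, ψ (a ^ 2) = ∑ y : K, ((quadraticChar K y : ℂ) + 1) * ψ y := by
    rw [← Finset.sum_fiberwise univ (fun a : K => a ^ 2)]
    refine Finset.sum_congr rfl fun y _ => ?_
    rw [← hcard, ← nsmul_eq_mul, ← Finset.sum_const]
    refine Finset.sum_congr rfl fun a ha => ?_
    rw [(Finset.mem_filter.mp ha).2]
  rw [hfib]
  simp_rw [add_mul, one_mul]
  rw [Finset.sum_add_distrib, AddChar.sum_eq_zero_of_ne_one hψ, add_zero]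

lemma sum_quadraticChar_mul_addChar_mul (ψ : AddChar K ℂ) {c : K} (hc : c ≠ 0) :
    ∑ y : K, (quadraticChar K y : ℂ) * ψ (c * y)
      = (quadraticChar K c : ℂ) * ∑ y : K, (quadraticChar K y : ℂ) * ψ y := by
  rw [Finset.mul_sum]
  refine Fintype.sum_bijective _ (mulLeft_bijective₀ c hc) _ _ fun y => ?_
  have h : (quadraticChar K c : ℂ) * quadraticChar K c = 1 := by
    have := quadraticChar_sq_one hc
    rw [sq] at this
    exact_mod_cast this
  rw [map_mul (quadraticChar K)]
  push_cast
  rw [← mul_assoc, ← mul_assoc, h, one_mul]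

/-- Evaluation of a quadratic exponential sum by completing the square. -/
lemma sum_addChar_quadratic (hK : ringChar K ≠ 2) {ψ : AddChar K ℂ} (hψ : ψ ≠ 1) {c : K}
    (hc : c ≠ 0) (b : K) :
    ∑ a : K, ψ (c * a ^ 2 + b * a) = ψ (-(b ^ 2 / (4 * c))) *
      ((quadraticChar K c : ℂ) * ∑ y : K, (quadraticChar K y : ℂ) * ψ y) := by
  have h2 : (2 : K) ≠ 0 := Ring.two_ne_zero hK
  have h4 : (4 : K) ≠ 0 := by
    have : (4 : K) = 2 * 2 := by norm_num
    rw [this]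
    exact mul_ne_zero h2 h2
  have hψc : ψ.mulShift c ≠ 1 := AddChar.IsPrimitive.of_ne_one hψ hc
  have hsq := sum_addChar_sq hK hψc
  simp only [AddChar.mulShift_apply] at hsq
  rw [sum_quadraticChar_mul_addChar_mul ψ hc] at hsq
  rw [← hsq, Finset.mul_sum]
  refine Fintype.sum_bijective (fun a => a + b / (2 * c))
    (AddGroup.addRight_bijective (b / (2 * c))) _ _ fun a => ?_
  rw [← AddChar.map_add_eq_mul]
  congr 1
  field_simp
  ring

end FiniteField

lemma exists_pow_div_two_eq_mul {q : ℕ} (hq : Odd q) (m : ℕ) :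
    ∃ S : ℕ, q ^ m / 2 = q / 2 * S ∧ (Even S ↔ Even m) := by
  induction m with
  | zero => exact ⟨0, by simp, by simp⟩
  | succ m ih =>
    obtain ⟨S, hS, hSm⟩ := ih
    refine ⟨q ^ m + S, ?_, ?_⟩
    · obtain ⟨k, hk⟩ := hq
      obtain ⟨l, hl⟩ := (show Odd q from ⟨k, hk⟩).pow (n := m)
      have h1 : q / 2 = k := by omega
      have h2 : q ^ m / 2 = l := by omega
      have h3 : q ^ (m + 1) = 2 * (k * q ^ m + l) + 1 := by
        rw [pow_succ]
        nth_rewrite 2 [hk]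
        linarith
      rw [h1, mul_add, ← h1, ← hS, h2, h1, h3]
      omega
    · have h := hq.pow (n := m)
      rw [Nat.even_add, Nat.even_add_one, hSm]
      simp [← Nat.not_odd_iff_even, h]

/-- The quadratic character of an extension, restricted to the prime field. -/
lemma quadraticChar_algebraMap {q m : ℕ} [Fact q.Prime] (hq : Odd q) {F : Type*} [Field F]
    [Fintype F] [DecidableEq F] [Algebra (ZMod q) F] (hF : Fintype.card F = q ^ m)
    (hF2 : ringChar F ≠ 2) {x : ZMod q} (hx : x ≠ 0) :
    quadraticChar F (algebraMap (ZMod q) F x) = if Even m then 1 else quadraticChar (ZMod q) x := by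
  have hq2 : ringChar (ZMod q) ≠ 2 := by
    rw [ZMod.ringChar_zmod_n]
    rintro rfl
    exact absurd hq (by decide)
  have hx' : algebraMap (ZMod q) F x ≠ 0 := by simpa using hx
  obtain ⟨S, hS, hSm⟩ := exists_pow_div_two_eq_mul hq m
  have hne : (-1 : F) ≠ 1 := Ring.neg_one_ne_one_of_char_ne_two hF2
  have hne' : (-1 : ZMod q) ≠ 1 := Ring.neg_one_ne_one_of_char_ne_two hq2
  rw [quadraticChar_eq_pow_of_char_ne_two hF2 hx', quadraticChar_eq_pow_of_char_ne_two hq2 hx,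
    hF, hS, ZMod.card, pow_mul, ← map_pow]
  have hd := FiniteField.pow_dichotomy hq2 hx
  rw [ZMod.card] at hd
  by_cases hm : Even m
  · have hS' := hSm.mpr hm
    rcases hd with h | h <;> simp [h, hm, hS'.neg_one_pow]
  · have hS' := Nat.not_even_iff_odd.mp (fun h => hm (hSm.mp h))
    rcases hd with h | h <;> simp [h, hm, hS'.neg_one_pow, hne, hne']

lemma AddChar.sum_filter_ne_zero_mul {K : Type*} [Field K] [Fintype K] [DecidableEq K]
    {ψ : AddChar K ℂ} (hψ : ψ ≠ 1) {c : K} (hc : c ≠ 0) :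
    ∑ x ∈ univ.filter (fun x : K => x ≠ 0), ψ (c * x) = -1 := by
  have h : ∑ x : K, ψ (c * x) = 0 :=
    AddChar.sum_eq_zero_of_ne_one (AddChar.IsPrimitive.of_ne_one hψ hc)
  rw [Finset.filter_ne', ← Finset.add_sum_erase univ _ (mem_univ (0 : K))] at *
  simp only [mul_zero, AddChar.map_zero_eq_one] at h
  linear_combination h

theorem stmt2 (q m : ℕ) [Fact q.Prime] (hq : Odd q) (hm : 2 ≤ m)
    (F : Type*) [Field F] [Fintype F] [DecidableEq F] [Algebra (ZMod q) F]
    (hF : Fintype.card F = q ^ m) (β : F) (hβ : β ≠ 0) (lam : ZMod q) (hlam : lam ≠ 0) :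
    (Even m → Algebra.trace (ZMod q) F (β ^ 2) = 0 →
      None q F β lam = -((q : ℂ) - 1) * gaussBig q F) ∧
    (Even m → Algebra.trace (ZMod q) F (β ^ 2) ≠ 0 →
      None q F β lam = gaussBig q F) ∧
    (Odd m → Algebra.trace (ZMod q) F (β ^ 2) = 0 →
      None q F β lam = 0) ∧
    (Odd m → Algebra.trace (ZMod q) F (β ^ 2) ≠ 0 →
      None q F β lam =
        -(quadraticChar (ZMod q) (-(Algebra.trace (ZMod q) F (β ^ 2))) : ℂ) *
          gaussBig q F * gaussSmall q) := by
  have hq2 : ringChar (ZMod q) ≠ 2 := by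
    rw [ZMod.ringChar_zmod_n]
    rintro rfl
    exact absurd hq (by decide)
  have hF2 : ringChar F ≠ 2 := by
    rwa [← Algebra.ringChar_eq (ZMod q) F]
  have h4 : (4 : ZMod q) ≠ 0 := by
    have : (4 : ZMod q) = 2 * 2 := by norm_num
    rw [this]
    exact mul_ne_zero (Ring.two_ne_zero hq2) (Ring.two_ne_zero hq2)
  set e : AddChar (ZMod q) ℂ := ZMod.stdAddChar
  have hz : ∀ s, zetaQ q s = e s := zetaQ_eq_stdAddChar q
  have he : e ≠ 1 := by
    have := ZMod.isPrimitive_stdAddChar q (one_ne_zero (α := ZMod q))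
    rwa [AddChar.mulShift_one] at this
  set T := Algebra.trace (ZMod q) F (β ^ 2) with hT
  set Ψ : AddChar F ℂ := e.compAddMonoidHom (Algebra.trace (ZMod q) F).toAddMonoidHom
  have hΨa : ∀ a, Ψ a = e (Algebra.trace (ZMod q) F a) := fun _ => rfl
  have hΨ : Ψ ≠ 1 := by
    obtain ⟨s, hs⟩ := AddChar.ne_one_iff.mp he
    obtain ⟨a, rfl⟩ := Algebra.trace_surjective (ZMod q) F s
    exact AddChar.ne_one_iff.mpr ⟨a, hs⟩
  have hG : gaussBig q F = ∑ y : F, (quadraticChar F y : ℂ) * Ψ y := by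
    rw [gaussBig, Finset.sum_filter_of_ne]
    · simp only [hz, hΨa]
    · rintro y - h rfl
      simp at h
  have hg : gaussSmall q = ∑ y : ZMod q, (quadraticChar (ZMod q) y : ℂ) * e y := by
    rw [gaussSmall, Finset.sum_filter_of_ne]
    · simp only [hz]
    · rintro y - h rfl
      simp at h
  have hinner (x z : ZMod q) (hx : x ≠ 0) :
      ∑ a : F, zetaQ q (x * Algebra.trace (ZMod q) F (a ^ 2)) *
        zetaQ q (z * Algebra.trace (ZMod q) F (β * a) - z * lam)
      = gaussBig q F * e (-lam * z) *
        (((if Even m then 1 else quadraticChar (ZMod q) x : ℤ) : ℂ) *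
          e (-(z ^ 2 * T / 4) * x⁻¹)) := by
    have hx' : algebraMap (ZMod q) F x ≠ 0 := by simpa using hx
    have h := sum_addChar_quadratic hF2 hΨ hx' (algebraMap (ZMod q) F z * β)
    rw [quadraticChar_algebraMap hq hF hF2 hx, ← hG] at h
    have htr : Ψ (-((algebraMap (ZMod q) F z * β) ^ 2 / (4 * algebraMap (ZMod q) F x)))
        = e (-(z ^ 2 * T / 4) * x⁻¹) := by
      have : -((algebraMap (ZMod q) F z * β) ^ 2 / (4 * algebraMap (ZMod q) F x))
          = (-(z ^ 2 / (4 * x))) • β ^ 2 := by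
        rw [Algebra.smul_def]
        simp only [map_neg, map_div₀, map_mul, map_pow, map_ofNat]
        ring
      rw [this, hΨa, map_smul, smul_eq_mul, ← hT]
      congr 1
      field_simp
    rw [htr] at h
    have hterm (a : F) : zetaQ q (x * Algebra.trace (ZMod q) F (a ^ 2)) *
        zetaQ q (z * Algebra.trace (ZMod q) F (β * a) - z * lam)
        = e (-lam * z) *
          Ψ (algebraMap (ZMod q) F x * a ^ 2 + algebraMap (ZMod q) F z * β * a) := by
      rw [hz, hz, hΨa, mul_assoc, ← Algebra.smul_def, ← Algebra.smul_def, map_add, map_smul,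
        map_smul, smul_eq_mul, smul_eq_mul, ← AddChar.map_add_eq_mul, ← AddChar.map_add_eq_mul]
      congr 1
      ring
    simp_rw [hterm]
    rw [← Finset.mul_sum, h]
    ring
  have hlamsum : ∑ z ∈ univ.filter (fun z : ZMod q => z ≠ 0), e (-lam * z) = -1 :=
    AddChar.sum_filter_ne_zero_mul he (neg_ne_zero.mpr hlam)
  have hN (C : ℂ) (hC : ∀ z : ZMod q, z ≠ 0 →
      ∑ x ∈ univ.filter (fun x : ZMod q => x ≠ 0),
        (((if Even m then 1 else quadraticChar (ZMod q) x : ℤ) : ℂ) *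
          e (-(z ^ 2 * T / 4) * x⁻¹)) = C) :
      None q F β lam = -gaussBig q F * C := by
    rw [None, Finset.sum_comm]
    have h1 : ∀ x ∈ univ.filter (fun x : ZMod q => x ≠ 0),
        ∑ a : F, ∑ z ∈ univ.filter (fun z : ZMod q => z ≠ 0),
          zetaQ q (x * Algebra.trace (ZMod q) F (a ^ 2)) *
            zetaQ q (z * Algebra.trace (ZMod q) F (β * a) - z * lam)
        = ∑ z ∈ univ.filter (fun z : ZMod q => z ≠ 0), gaussBig q F * e (-lam * z) *
          (((if Even m then 1 else quadraticChar (ZMod q) x : ℤ) : ℂ) *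
            e (-(z ^ 2 * T / 4) * x⁻¹)) := by
      intro x hx
      rw [Finset.sum_comm]
      exact Finset.sum_congr rfl fun z _ => hinner x z (Finset.mem_filter.mp hx).2
    rw [Finset.sum_congr rfl h1, Finset.sum_comm]
    have h2 : ∀ z ∈ univ.filter (fun z : ZMod q => z ≠ 0),
        ∑ x ∈ univ.filter (fun x : ZMod q => x ≠ 0), gaussBig q F * e (-lam * z) *
          (((if Even m then 1 else quadraticChar (ZMod q) x : ℤ) : ℂ) *
            e (-(z ^ 2 * T / 4) * x⁻¹)) = gaussBig q F * C * e (-lam * z) := by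
      intro z hz'
      rw [← Finset.mul_sum, hC z (Finset.mem_filter.mp hz').2]
      ring
    rw [Finset.sum_congr rfl h2, ← Finset.mul_sum, hlamsum]
    ring
  have hinv (f : ZMod q → ℂ) : ∑ x ∈ univ.filter (fun x : ZMod q => x ≠ 0), f x⁻¹
      = ∑ x ∈ univ.filter (fun x : ZMod q => x ≠ 0), f x :=
    Finset.sum_nbij' (fun x => x⁻¹) (fun x => x⁻¹) (by simp) (by simp) (by simp) (by simp)
      (by simp)
  have hχinv (x : ZMod q) : quadraticChar (ZMod q) x = quadraticChar (ZMod q) x⁻¹ := by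
    have h := MulChar.inv_apply' (quadraticChar (ZMod q)) x
    rwa [(quadraticChar_isQuadratic (ZMod q)).inv] at h
  have hcoef (z : ZMod q) (hz' : z ≠ 0) (hT0 : T ≠ 0) : -(z ^ 2 * T / 4) ≠ 0 :=
    neg_ne_zero.mpr (div_ne_zero (mul_ne_zero (pow_ne_zero 2 hz') hT0) h4)
  refine ⟨fun hm' hT0 => ?_, fun hm' hT0 => ?_, fun hm' hT0 => ?_, fun hm' hT0 => ?_⟩
  · rw [hN ((q : ℂ) - 1)]
    · ring
    · intro z _
      have hq1 : 1 ≤ q := (Fact.out : q.Prime).one_le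
      simp [hm', hT0, Finset.filter_ne', ZMod.card, Nat.cast_sub hq1]
  · rw [hN (-1)]
    · ring
    · intro z hz'
      simp only [hm', if_true, Int.cast_one, one_mul]
      rw [hinv fun x => e (-(z ^ 2 * T / 4) * x)]
      exact AddChar.sum_filter_ne_zero_mul he (hcoef z hz' hT0)
  · rw [hN 0]
    · ring
    · intro z _
      have h := quadraticChar_sum_zero hq2
      simp only [Nat.not_even_iff_odd.mpr hm', if_false, hT0, mul_zero, zero_div, neg_zero,
        zero_mul, AddChar.map_zero_eq_one, mul_one]
      rw [Finset.sum_filter_of_ne]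
      · exact_mod_cast h
      · rintro y - h rfl
        simp at h
  · rw [hN ((quadraticChar (ZMod q) (-T) : ℂ) * gaussSmall q)]
    · ring
    · intro z hz'
      simp only [Nat.not_even_iff_odd.mpr hm', if_false]
      rw [Finset.sum_congr rfl fun x _ => by rw [hχinv x], hinv fun x => (quadraticChar (ZMod q) x : ℂ) * e (-(z ^ 2 * T / 4) * x),
        Finset.sum_filter_of_ne, sum_quadraticChar_mul_addChar_mul e (hcoef z hz' hT0), ← hg]
      · have h2 : z / 2 ≠ 0 := div_ne_zero hz' (Ring.two_ne_zero hq2)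
        have : -(z ^ 2 * T / 4) = (z / 2) ^ 2 * -T := by
          rw [div_pow, show (2 : ZMod q) ^ 2 = 4 by norm_num]
          ring
        rw [this, map_mul (quadraticChar (ZMod q)), quadraticChar_sq_one' h2, one_mul]
      · rintro y - h rfl
        simp at h
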